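/- For all real ν ≥ 0 and all x > 0, I_ν(x)·K_ν(x) > √3/(2g·sin((1/3)·arccos(h/g³) + π/3)), where g = √(3(ν² + x²) + 1) and h = 9ν² − (9/2)x² − 1. -/

import Mathlib

open Real

/-- Modified Bessel function of the first kind `I_ν(x)` (for `x > 0`),
defined by its standard power series. -/
noncomputable def besselI (ν x : ℝ) : ℝ :=
  ∑' k : ℕ, (x / 2) ^ (2 * k) / ((Nat.factorial k : ℝ) * Real.Gamma (k + ν + 1)) * (x / 2) ^ ν

/-- Modified Bessel function of the second kind `K_ν(x)` (for `x > 0`),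
defined by its standard integral representation. -/
noncomputable def besselK (ν x : ℝ) : ℝ :=
  ∫ t in Set.Ioi (0 : ℝ), Real.exp (-x * Real.cosh t) * Real.cosh (ν * t)


lemma aux_M_deriv (m : ℝ) (f f1 : ℝ → ℝ) (s : ℝ) (hs : 0 < s) (hf : f s ≠ 0)
    (h0 : HasDerivAt f (f1 s) s) (h1 : HasDerivAt f1 ((f s - (m + 1) * f1 s) / s) s) :
    HasDerivAt (fun s => s ^ (m + 1) * ((f s ^ 2 - m * f s * f1 s - s * f1 s ^ 2) *
      (m + 1 + 2 * s * f1 s / f s) - f s ^ 2))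
      (2 * s ^ (m + 1) * (f s ^ 2 - m * f s * f1 s - s * f1 s ^ 2) ^ 2 / f s ^ 2) s := by
  have hid := hasDerivAt_id s
  have hp : HasDerivAt (fun s : ℝ => s ^ (m + 1)) ((m + 1) * (s ^ (m + 1) / s)) s := by
    have := hasDerivAt_rpow_const (x := s) (p := m + 1) (Or.inl hs.ne')
    rwa [rpow_sub_one hs.ne'] at this
  have hN := ((h0.pow 2).sub ((h0.const_mul m).mul h1)).sub (hid.mul (h1.pow 2))
  have hq := (((hid.const_mul 2).mul h1).div h0 hf).const_add (m + 1)
  have := hp.mul ((hN.mul hq).sub (h0.pow 2))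
  refine this.congr_deriv ?_
  simp only [Pi.mul_apply, Pi.sub_apply, Pi.pow_apply, Pi.div_apply, id]
  field_simp
  ring

lemma aux_trig (ν x y z : ℝ) (hx : 0 < x)
    (hy : (y ^ 2 - (ν ^ 2 + x ^ 2)) * (y + 1) + x ^ 2 < 0)
    (hz : 0 < (z ^ 2 - (ν ^ 2 + x ^ 2)) * (z + 1) + x ^ 2) (hyz : z < y) :
    1 / (y - z) > Real.sqrt 3 / (2 * Real.sqrt (3 * (ν ^ 2 + x ^ 2) + 1) *
        Real.sin (1 / 3 * Real.arccos ((9 * ν ^ 2 - 9 / 2 * x ^ 2 - 1) /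
          Real.sqrt (3 * (ν ^ 2 + x ^ 2) + 1) ^ 3) + π / 3)) := by
  have hgpos : 0 < Real.sqrt (3 * (ν ^ 2 + x ^ 2) + 1) := Real.sqrt_pos.2 (by positivity)
  have hg2 : Real.sqrt (3 * (ν ^ 2 + x ^ 2) + 1) ^ 2 = 3 * (ν ^ 2 + x ^ 2) + 1 :=
    Real.sq_sqrt (by positivity)
  set g := Real.sqrt (3 * (ν ^ 2 + x ^ 2) + 1) with hg
  set h := 9 * ν ^ 2 - 9 / 2 * x ^ 2 - 1 with hh
  have hle : |h / g ^ 3| ≤ 1 := by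
    rw [abs_div, abs_of_pos (pow_pos hgpos 3), div_le_one (pow_pos hgpos 3)]
    apply abs_le_of_sq_le_sq _ (by positivity)
    have : (g ^ 3) ^ 2 = (3 * (ν ^ 2 + x ^ 2) + 1) ^ 3 := by rw [← hg2]; ring
    rw [this]
    have e : (3 * (ν ^ 2 + x ^ 2) + 1) ^ 3 - h ^ 2 = 27 * (ν ^ 2 * (ν ^ 2 - 1) ^ 2 +
      3 * ν ^ 4 * x ^ 2 + 3 * ν ^ 2 * x ^ 4 + x ^ 6 + x ^ 4 / 4 + 5 * ν ^ 2 * x ^ 2) := by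
      rw [hh]; ring
    have : 0 ≤ (3 * (ν ^ 2 + x ^ 2) + 1) ^ 3 - h ^ 2 := by rw [e]; positivity
    linarith
  obtain ⟨hl, hr⟩ := abs_le.1 hle
  set θ := 1 / 3 * Real.arccos (h / g ^ 3) with hθ
  have hθ0 : 0 ≤ θ := by have := Real.arccos_nonneg (h / g ^ 3); positivity
  have hθ1 : θ ≤ π / 3 := by have := Real.arccos_le_pi (h / g ^ 3); rw [hθ]; linarith
  have hpi := Real.pi_pos
  have h3 : Real.cos (3 * θ) = h / g ^ 3 := by
    rw [hθ, show 3 * (1 / 3 * Real.arccos (h / g ^ 3)) = Real.arccos (h / g ^ 3) by ring,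
      Real.cos_arccos hl hr]
  rw [Real.cos_three_mul, eq_div_iff (by positivity)] at h3
  have hsq : Real.sqrt 3 ^ 2 = 3 := Real.sq_sqrt (by norm_num)
  have hs3 : 0 < Real.sqrt 3 := by positivity
  have hcs := Real.sin_sq_add_cos_sq θ
  have hc : 1 / 2 ≤ Real.cos θ := by
    rw [← Real.cos_pi_div_three]
    exact Real.cos_le_cos_of_nonneg_of_le_pi hθ0 (by linarith) hθ1
  have hS : 0 ≤ Real.sin θ := Real.sin_nonneg_of_nonneg_of_le_pi hθ0 (by linarith)
  have hSC : Real.sin θ ≤ Real.sqrt 3 * Real.cos θ := by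
    apply abs_le_of_sq_le_sq' _ (by positivity) |>.2
    rw [mul_pow, hsq]; nlinarith
  have hsin : Real.sin (θ + π / 3) = Real.sin θ / 2 + Real.cos θ * Real.sqrt 3 / 2 := by
    rw [Real.sin_add, Real.cos_pi_div_three, Real.sin_pi_div_three]; ring
  have hsp : 0 < Real.sin (θ + π / 3) := by rw [hsin]; positivity
  set c := Real.cos θ
  set S := Real.sin θ
  have fac : ∀ w : ℝ, (w ^ 2 - (ν ^ 2 + x ^ 2)) * (w + 1) + x ^ 2 =
      (w + 1 / 3 - 2 * g / 3 * c) * (w + 1 / 3 - 2 * g / 3 * (- c / 2 - Real.sqrt 3 / 2 * S)) *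
      (w + 1 / 3 - 2 * g / 3 * (- c / 2 + Real.sqrt 3 / 2 * S)) := by
    intro w
    have hS2 : S ^ 2 = 1 - c ^ 2 := by linarith
    have e : (w + 1 / 3 - 2 * g / 3 * c) * (w + 1 / 3 - 2 * g / 3 * (- c / 2 - Real.sqrt 3 / 2 * S)) *
      (w + 1 / 3 - 2 * g / 3 * (- c / 2 + Real.sqrt 3 / 2 * S)) =
      (w + 1 / 3) ^ 3 - (w + 1 / 3) * (g ^ 2 / 3) - 2 / 27 * ((4 * c ^ 3 - 3 * c) * g ^ 3) := by
      have : (w + 1 / 3 - 2 * g / 3 * c) * (w + 1 / 3 - 2 * g / 3 * (- c / 2 - Real.sqrt 3 / 2 * S)) *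
        (w + 1 / 3 - 2 * g / 3 * (- c / 2 + Real.sqrt 3 / 2 * S)) =
        (w + 1 / 3 - 2 * g / 3 * c) * ((w + 1 / 3 + g / 3 * c) ^ 2 -
          g ^ 2 / 9 * Real.sqrt 3 ^ 2 * S ^ 2) := by ring
      rw [this, hsq, hS2]; ring
    rw [e, h3, hg2, hh]; ring
  rw [fac] at hy hz
  have hgS : 0 ≤ g * (Real.sqrt 3 * S) := by positivity
  have hgc : g * S * Real.sqrt 3 ≤ g * (3 * c) := by
    have h5 : S * Real.sqrt 3 ≤ 3 * c := by
      have := mul_le_mul_of_nonneg_left hSC hs3.le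
      rw [← mul_assoc, ← pow_two, hsq] at this
      linarith
    have := mul_le_mul_of_nonneg_left h5 hgpos.le
    linarith
  have hgc0 : 0 ≤ g * c := by positivity
  have hy' : y + 1 / 3 < 2 * g / 3 * c := by
    by_contra hcon
    push Not at hcon
    refine absurd hy (not_lt.2 (mul_nonneg (mul_nonneg ?_ ?_) ?_)) <;> linarith
  have hz' : 2 * g / 3 * (- c / 2 - Real.sqrt 3 / 2 * S) < z + 1 / 3 := by
    by_contra hcon
    push Not at hcon
    refine absurd hz (not_lt.2 (mul_nonpos_of_nonneg_of_nonpos (mul_nonneg_of_nonpos_of_nonpos ?_ ?_) ?_)) <;> linarith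
  rw [gt_iff_lt, div_lt_div_iff₀ (by positivity) (by linarith), hsin]
  have : y - z < 2 * g / 3 * c - 2 * g / 3 * (- c / 2 - Real.sqrt 3 / 2 * S) := by linarith
  have := mul_lt_mul_of_pos_left this hs3
  refine this.trans_eq ?_
  linear_combination (g / 3 * S) * hsq


/-- entire part of I -/
noncomputable def auxA (ν s : ℝ) : ℝ := ∑' k : ℕ, s ^ k / ((Nat.factorial k : ℝ) * Real.Gamma (k + ν + 1))

lemma auxA_gamma_pos (ν : ℝ) (hν : 0 ≤ ν) (k : ℕ) : 0 < Real.Gamma (k + ν + 1) :=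
  Real.Gamma_pos_of_pos (by positivity)

lemma auxA_gamma_ge (ν : ℝ) (hν : 0 ≤ ν) (k : ℕ) : Real.Gamma (ν + 1) ≤ Real.Gamma (k + ν + 1) := by
  induction k with
  | zero => simp
  | succ k ih =>
    have e : Real.Gamma ((k + 1 : ℕ) + ν + 1) = (k + ν + 1) * Real.Gamma (k + ν + 1) := by
      rw [← Real.Gamma_add_one (by positivity)]; congr 1; push_cast; ring
    rw [e]
    have := auxA_gamma_pos ν hν k
    have hk : (0:ℝ) ≤ k := by positivity
    nlinarith [mul_nonneg (add_nonneg hk hν) this.le]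

lemma auxA_term_le (ν : ℝ) (hν : 0 ≤ ν) (s R : ℝ) (hs : |s| ≤ R) (k : ℕ) :
    ‖s ^ k / ((Nat.factorial k : ℝ) * Real.Gamma (k + ν + 1))‖ ≤
      R ^ k / (Nat.factorial k : ℝ) / Real.Gamma (ν + 1) := by
  have h1 := auxA_gamma_pos ν hν k
  have h2 := auxA_gamma_ge ν hν k
  have h3 : 0 < Real.Gamma (ν + 1) := Real.Gamma_pos_of_pos (by positivity)
  have hR : 0 ≤ R := (abs_nonneg s).trans hs
  rw [norm_div, norm_pow, Real.norm_eq_abs, Real.norm_eq_abs, abs_of_pos (by positivity : 0 < (Nat.factorial k : ℝ) * Real.Gamma (k + ν + 1)), div_div]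
  gcongr

lemma auxA_bound_summable (ν R : ℝ) :
    Summable fun k : ℕ => R ^ k / (Nat.factorial k : ℝ) / Real.Gamma (ν + 1) :=
  (Real.summable_pow_div_factorial R).div_const _

lemma auxA_summable (ν : ℝ) (hν : 0 ≤ ν) (s : ℝ) :
    Summable fun k : ℕ => s ^ k / ((Nat.factorial k : ℝ) * Real.Gamma (k + ν + 1)) :=
  Summable.of_norm_bounded (auxA_bound_summable ν |s|) (auxA_term_le ν hν s |s| le_rfl)

lemma auxA_hasDerivAt (ν : ℝ) (hν : 0 ≤ ν) (s : ℝ) : HasDerivAt (auxA ν) (auxA (ν + 1) s) s := by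
  have hterm : ∀ (k : ℕ) (y : ℝ), ((k + 1 : ℕ) : ℝ) * y ^ k / ((Nat.factorial (k + 1) : ℝ) * Real.Gamma ((k + 1 : ℕ) + ν + 1))
      = y ^ k / ((Nat.factorial k : ℝ) * Real.Gamma (k + (ν + 1) + 1)) := by
    intro k y
    have h1 := auxA_gamma_pos (ν + 1) (by positivity) k
    rw [show ((k + 1 : ℕ) : ℝ) + ν + 1 = k + (ν + 1) + 1 by push_cast; ring, Nat.factorial_succ]
    push_cast
    field_simp
  set R := |s| + 1 with hR
  have hR0 : 0 < R := by positivity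
  have key := hasDerivAt_tsum_of_isPreconnected
    (u := fun k : ℕ => (k : ℝ) * R ^ (k - 1) / ((Nat.factorial k : ℝ) * Real.Gamma (k + ν + 1)))
    (g := fun (k : ℕ) (y : ℝ) => y ^ k / ((Nat.factorial k : ℝ) * Real.Gamma (k + ν + 1)))
    (g' := fun (k : ℕ) (y : ℝ) => (k : ℝ) * y ^ (k - 1) / ((Nat.factorial k : ℝ) * Real.Gamma (k + ν + 1)))
    (t := Metric.ball (0 : ℝ) R) (y₀ := 0) (y := s) ?_ Metric.isOpen_ball
    (convex_ball (0 : ℝ) R).isPreconnected ?_ ?_ (Metric.mem_ball_self hR0) (auxA_summable ν hν 0) ?_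
  · refine key.congr_deriv ?_
    rw [Summable.tsum_eq_zero_add]
    · simp only [Nat.add_sub_cancel, hterm]
      simp [auxA]
    · rw [← summable_nat_add_iff 1]
      simp only [Nat.add_sub_cancel, hterm]
      exact auxA_summable (ν + 1) (by positivity) s
  · rw [← summable_nat_add_iff 1]
    simp only [Nat.add_sub_cancel, hterm]
    exact auxA_summable (ν + 1) (by positivity) R
  · intro k y _
    exact (hasDerivAt_pow k y).div_const _
  · intro k y hy
    have h1 := auxA_gamma_pos ν hν k
    rw [norm_div, norm_mul, norm_pow, Real.norm_eq_abs, Real.norm_eq_abs, Real.norm_eq_abs,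
      abs_of_nonneg (by positivity : (0:ℝ) ≤ k), abs_of_pos (by positivity : 0 < (Nat.factorial k : ℝ) * Real.Gamma (k + ν + 1))]
    have : |y| ≤ R := by simpa using (Metric.mem_ball.1 hy).le
    gcongr
  · simp [hR]

lemma auxA_rec (ν : ℝ) (hν : 0 ≤ ν) (s : ℝ) :
    s * auxA (ν + 2) s = auxA ν s - (ν + 1) * auxA (ν + 1) s := by
  have s0 := auxA_summable ν hν s
  have s1 := (auxA_summable (ν + 1) (by positivity) s).mul_left (ν + 1)
  unfold auxA
  rw [← tsum_mul_left, ← tsum_mul_left, ← s0.tsum_sub s1, (s0.sub s1).tsum_eq_zero_add]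
  have hz : s ^ 0 / ((Nat.factorial 0 : ℝ) * Real.Gamma ((0 : ℕ) + ν + 1)) -
      (ν + 1) * (s ^ 0 / ((Nat.factorial 0 : ℝ) * Real.Gamma ((0 : ℕ) + (ν + 1) + 1))) = 0 := by
    have : 0 < Real.Gamma (ν + 1) := Real.Gamma_pos_of_pos (by positivity)
    simp only [Nat.cast_zero, zero_add, Nat.factorial_zero, Nat.cast_one, pow_zero, one_mul]
    rw [Real.Gamma_add_one (s := ν + 1) (by positivity)]
    field_simp
    ring
  rw [hz, zero_add]
  congr 1
  ext k
  have h1 := auxA_gamma_pos (ν + 1) (by positivity) k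
  have e1 : Real.Gamma (k + (ν + 2) + 1) = (k + (ν + 1) + 1) * Real.Gamma (k + (ν + 1) + 1) := by
    rw [← Real.Gamma_add_one (by positivity)]; congr 1; ring
  have e2 : Real.Gamma ((k + 1 : ℕ) + ν + 1) = Real.Gamma (k + (ν + 1) + 1) := by
    congr 1; push_cast; ring
  have e3 : Real.Gamma ((k + 1 : ℕ) + (ν + 1) + 1) = (k + (ν + 1) + 1) * Real.Gamma (k + (ν + 1) + 1) := by
    rw [← Real.Gamma_add_one (by positivity)]; congr 1; push_cast; ring
  rw [e1, e2, e3, Nat.factorial_succ]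
  have : (k : ℝ) + (ν + 1) + 1 ≠ 0 := by positivity
  push_cast
  field_simp
  ring

lemma auxA_pos (ν : ℝ) (hν : 0 ≤ ν) (s : ℝ) (hs : 0 ≤ s) : 0 < auxA ν s := by
  refine (auxA_summable ν hν s).tsum_pos (fun k => ?_) 0 ?_
  · have := auxA_gamma_pos ν hν k
    positivity
  · have := auxA_gamma_pos ν hν 0
    positivity

lemma auxA_zero (ν : ℝ) : auxA ν 0 = 1 / Real.Gamma (ν + 1) := by
  unfold auxA
  rw [tsum_eq_single 0]
  · simp
  · intro k hk; simp [hk]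

section

open MeasureTheory Filter Topology


noncomputable def auxJ (μ s : ℝ) : ℝ := ∫ t : ℝ, Real.exp (μ * t - Real.exp t - s * Real.exp (-t))

lemma auxJ_integrable_zero (μ : ℝ) (hμ : 0 < μ) :
    Integrable (fun t : ℝ => Real.exp (μ * t - Real.exp t)) ∧
    ∫ t : ℝ, Real.exp (μ * t - Real.exp t) = Real.Gamma μ := by
  have hd : ∀ t ∈ (Set.univ : Set ℝ), HasDerivWithinAt Real.exp (Real.exp t) Set.univ t :=
    fun t _ => (Real.hasDerivAt_exp t).hasDerivWithinAt
  have hinj : Set.InjOn Real.exp Set.univ := Real.exp_injective.injOn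
  have him : Real.exp '' Set.univ = Set.Ioi 0 := by rw [Set.image_univ, Real.range_exp]
  have e : ∀ t : ℝ, |Real.exp t| • (Real.exp (-Real.exp t) * Real.exp t ^ (μ - 1)) =
      Real.exp (μ * t - Real.exp t) := by
    intro t
    rw [abs_of_pos (Real.exp_pos t), smul_eq_mul, ← Real.exp_mul, ← Real.exp_add, ← Real.exp_add]
    congr 1; ring
  constructor
  · have h := Real.GammaIntegral_convergent hμ
    rw [← him, integrableOn_image_iff_integrableOn_abs_deriv_smul MeasurableSet.univ hd hinj] at h
    simp only [e] at h
    exact integrableOn_univ.1 h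
  · rw [Real.Gamma_eq_integral hμ, ← him,
      integral_image_eq_integral_abs_deriv_smul MeasurableSet.univ hd hinj]
    simp only [e]
    simp

lemma aux_exp_neg_le (y : ℝ) (hy : 0 < y) (k : ℕ) : Real.exp (-y) ≤ (Nat.factorial k : ℝ) / y ^ k := by
  have := Real.pow_div_factorial_le_exp y hy.le k
  rw [Real.exp_neg, inv_le_comm₀ (Real.exp_pos _) (by positivity), inv_div]
  exact this

lemma auxJ_integrand_le (μ s t : ℝ) (hs : 0 < s) (k : ℕ) :
    Real.exp (μ * t - Real.exp t - s * Real.exp (-t)) ≤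
      (Nat.factorial k : ℝ) / s ^ k * Real.exp ((μ + k) * t - Real.exp t) := by
  have h := aux_exp_neg_le (s * Real.exp (-t)) (by positivity) k
  calc Real.exp (μ * t - Real.exp t - s * Real.exp (-t))
      = Real.exp (μ * t - Real.exp t) * Real.exp (-(s * Real.exp (-t))) := by
        rw [← Real.exp_add]; congr 1
    _ ≤ Real.exp (μ * t - Real.exp t) * ((Nat.factorial k : ℝ) / (s * Real.exp (-t)) ^ k) := by gcongr
    _ = _ := by
        rw [mul_pow, ← Real.exp_nat_mul, show (μ + k) * t - Real.exp t = (μ * t - Real.exp t) - k * (-t) by ring,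
          Real.exp_sub _ ((k : ℝ) * (-t))]
        field_simp

lemma auxJ_integrable (μ s : ℝ) (hs : 0 < s) :
    Integrable (fun t : ℝ => Real.exp (μ * t - Real.exp t - s * Real.exp (-t))) := by
  obtain ⟨k, hk⟩ := exists_nat_gt (-μ)
  refine Integrable.mono' ((auxJ_integrable_zero (μ + k) (by linarith)).1.const_mul ((Nat.factorial k : ℝ) / s ^ k))
    (by fun_prop) ?_
  refine Eventually.of_forall fun t => ?_
  rw [Real.norm_eq_abs, abs_of_pos (Real.exp_pos _)]
  exact auxJ_integrand_le μ s t hs k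

lemma auxJ_pos (μ s : ℝ) (hs : 0 < s) : 0 < auxJ μ s := by
  unfold auxJ
  rw [integral_pos_iff_support_of_nonneg (fun t => (Real.exp_pos _).le) (auxJ_integrable μ s hs)]
  have : Function.support (fun t : ℝ => Real.exp (μ * t - Real.exp t - s * Real.exp (-t))) = Set.univ := by
    ext t; simp [Real.exp_ne_zero]
  rw [this]; simp

lemma auxJ_le (μ s : ℝ) (hs : 0 < s) (k : ℕ) (hk : 0 < μ + k) :
    auxJ μ s ≤ (Nat.factorial k : ℝ) / s ^ k * Real.Gamma (μ + k) := by
  rw [← (auxJ_integrable_zero (μ + k) hk).2, ← integral_const_mul]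
  exact integral_mono (auxJ_integrable μ s hs) ((auxJ_integrable_zero (μ + k) hk).1.const_mul _)
    (fun t => auxJ_integrand_le μ s t hs k)

lemma auxJ_rec (μ s : ℝ) (hs : 0 < s) :
    auxJ (μ + 1) s = μ * auxJ μ s + s * auxJ (μ - 1) s := by
  have e1 : ∀ t, Real.exp ((μ + 1) * t - Real.exp t - s * Real.exp (-t)) =
      Real.exp t * Real.exp (μ * t - Real.exp t - s * Real.exp (-t)) := by
    intro t; rw [← Real.exp_add]; congr 1; ring
  have e2 : ∀ t, Real.exp ((μ - 1) * t - Real.exp t - s * Real.exp (-t)) =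
      Real.exp (-t) * Real.exp (μ * t - Real.exp t - s * Real.exp (-t)) := by
    intro t; rw [← Real.exp_add]; congr 1; ring
  have i0 := (auxJ_integrable μ s hs)
  have i1 := (auxJ_integrable (μ + 1) s hs)
  have i2 := (auxJ_integrable (μ - 1) s hs)
  have hd : ∀ t, HasDerivAt (fun t : ℝ => Real.exp (μ * t - Real.exp t - s * Real.exp (-t)))
      (μ * Real.exp (μ * t - Real.exp t - s * Real.exp (-t)) +
        s * Real.exp ((μ - 1) * t - Real.exp t - s * Real.exp (-t)) -
        Real.exp ((μ + 1) * t - Real.exp t - s * Real.exp (-t))) t := by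
    intro t
    have := ((((hasDerivAt_id t).const_mul μ).sub (Real.hasDerivAt_exp t)).sub
      ((hasDerivAt_neg t).exp.const_mul s)).exp
    refine this.congr_deriv ?_
    rw [e1, e2]
    simp only [id, Pi.sub_apply]
    ring
  have := integral_eq_zero_of_hasDerivAt_of_integrable hd
    (((i0.const_mul μ).add (i2.const_mul s)).sub i1) i0
  have hs1 := integral_sub ((i0.const_mul μ).add (i2.const_mul s)) i1
  simp only [Pi.add_apply] at hs1
  rw [hs1, integral_add (i0.const_mul μ) (i2.const_mul s), integral_const_mul, integral_const_mul] at this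
  unfold auxJ
  linarith

lemma auxJ_hasDerivAt (μ s : ℝ) (hs : 0 < s) : HasDerivAt (auxJ μ) (-auxJ (μ - 1) s) s := by
  have e2 : ∀ r t, Real.exp ((μ - 1) * t - Real.exp t - r * Real.exp (-t)) =
      Real.exp (-t) * Real.exp (μ * t - Real.exp t - r * Real.exp (-t)) := by
    intro r t; rw [← Real.exp_add]; congr 1; ring
  have key := hasDerivAt_integral_of_dominated_loc_of_deriv_le (μ := (volume : Measure ℝ))
    (F := fun r t => Real.exp (μ * t - Real.exp t - r * Real.exp (-t)))
    (F' := fun r t => -Real.exp ((μ - 1) * t - Real.exp t - r * Real.exp (-t)))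
    (bound := fun t => Real.exp ((μ - 1) * t - Real.exp t - (s / 2) * Real.exp (-t)))
    (x₀ := s) (s := Set.Ioi (s / 2)) (Ioi_mem_nhds (by linarith)) ?_ (auxJ_integrable μ s hs) ?_ ?_ 
    (auxJ_integrable (μ - 1) (s / 2) (by linarith)) ?_
  · refine key.2.congr_deriv ?_
    rw [integral_neg]; rfl
  · exact Eventually.of_forall fun r => by fun_prop
  · fun_prop
  · refine Eventually.of_forall fun t r hr => ?_
    rw [norm_neg, Real.norm_eq_abs, abs_of_pos (Real.exp_pos _)]
    have : s / 2 < r := hr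
    gcongr
  · refine Eventually.of_forall fun t r hr => ?_
    have := (((hasDerivAt_id r).mul_const (Real.exp (-t))).const_sub (μ * t - Real.exp t)).exp
    refine this.congr_deriv ?_
    rw [e2]
    simp only [id]
    ring

lemma auxJ_tendsto (μ : ℝ) (hμ : 0 < μ) : Tendsto (auxJ μ) (𝓝[>] 0) (𝓝 (Real.Gamma μ)) := by
  rw [← (auxJ_integrable_zero μ hμ).2]
  refine tendsto_integral_filter_of_dominated_convergence _ ?_ ?_ (auxJ_integrable_zero μ hμ).1 ?_
  · exact Eventually.of_forall fun r => by fun_prop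
  · filter_upwards [self_mem_nhdsWithin] with r hr
    refine Eventually.of_forall fun t => ?_
    rw [Real.norm_eq_abs, abs_of_pos (Real.exp_pos _)]
    have : 0 < r := hr
    have : 0 < r * Real.exp (-t) := by positivity
    exact Real.exp_le_exp.2 (by linarith)
  · refine Eventually.of_forall fun t => ?_
    have : ContinuousAt (fun r : ℝ => Real.exp (μ * t - Real.exp t - r * Real.exp (-t))) 0 := by fun_prop
    have h := this.tendsto
    simp only [zero_mul, sub_zero] at h
    exact h.mono_left nhdsWithin_le_nhds

lemma auxJ_conv (μ s : ℝ) (hs : 0 < s) : 2 * auxJ (μ - 1) s ≤ auxJ μ s + auxJ (μ - 2) s := by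
  unfold auxJ
  rw [← integral_const_mul, ← integral_add (auxJ_integrable _ s hs) (auxJ_integrable _ s hs)]
  refine integral_mono ((auxJ_integrable _ s hs).const_mul 2) ((auxJ_integrable _ s hs).add (auxJ_integrable _ s hs)) fun t => ?_
  have e1 : Real.exp (μ * t - Real.exp t - s * Real.exp (-t)) =
      Real.exp t * Real.exp ((μ - 1) * t - Real.exp t - s * Real.exp (-t)) := by
    rw [← Real.exp_add]; congr 1; ring
  have e2 : Real.exp ((μ - 2) * t - Real.exp t - s * Real.exp (-t)) =
      Real.exp (-t) * Real.exp ((μ - 1) * t - Real.exp t - s * Real.exp (-t)) := by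
    rw [← Real.exp_add]; congr 1; ring
  simp only [e1, e2]
  rw [← add_mul]
  gcongr
  have := Real.one_le_cosh t
  rw [Real.cosh_eq] at this
  linarith

lemma auxA_M_pos (ν : ℝ) (hν : 0 ≤ ν) (s : ℝ) (hs : 0 < s) :
    0 < (auxA ν s ^ 2 - ν * auxA ν s * auxA (ν + 1) s - s * auxA (ν + 1) s ^ 2) *
      (ν + 1 + 2 * s * auxA (ν + 1) s / auxA ν s) - auxA ν s ^ 2 := by
  set M : ℝ → ℝ := fun s => s ^ (ν + 1) * ((auxA ν s ^ 2 - ν * auxA ν s * auxA (ν + 1) s - s * auxA (ν + 1) s ^ 2) *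
      (ν + 1 + 2 * s * auxA (ν + 1) s / auxA ν s) - auxA ν s ^ 2) with hM
  have hd : ∀ s : ℝ, 0 < s → HasDerivAt M (2 * s ^ (ν + 1) * (auxA ν s ^ 2 - ν * auxA ν s * auxA (ν + 1) s - s * auxA (ν + 1) s ^ 2) ^ 2 / auxA ν s ^ 2) s := by
    intro s hs
    refine aux_M_deriv ν (auxA ν) (auxA (ν + 1)) s hs (auxA_pos ν hν s hs.le).ne' (auxA_hasDerivAt ν hν s) ?_
    have := auxA_hasDerivAt (ν + 1) (by positivity) s
    refine this.congr_deriv ?_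
    rw [eq_div_iff hs.ne', ← auxA_rec ν hν s, mul_comm]
    congr 2; ring
  have c0 : Continuous (auxA ν) := continuous_iff_continuousAt.2 fun s => (auxA_hasDerivAt ν hν s).continuousAt
  have c1 : Continuous (auxA (ν + 1)) :=
    continuous_iff_continuousAt.2 fun s => (auxA_hasDerivAt (ν + 1) (by positivity) s).continuousAt
  have hc : ContinuousOn M (Set.Ici 0) := by
    have hp : Continuous fun s : ℝ => s ^ (ν + 1) := Real.continuous_rpow_const (by positivity)
    refine hp.continuousOn.mul (ContinuousOn.sub (ContinuousOn.mul (by fun_prop) ?_) (by fun_prop))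
    refine continuousOn_const.add (ContinuousOn.div (by fun_prop) (by fun_prop) ?_)
    intro s hs
    exact (auxA_pos ν hν s hs).ne'
  have hM0 : M 0 = 0 := by
    simp only [hM]; rw [Real.zero_rpow (by positivity), zero_mul]
  have hmono : MonotoneOn M (Set.Ici 0) := by
    refine monotoneOn_of_hasDerivWithinAt_nonneg (f' := fun s => (2 * s ^ (ν + 1) * (auxA ν s ^ 2 - ν * auxA ν s * auxA (ν + 1) s - s * auxA (ν + 1) s ^ 2) ^ 2 / auxA ν s ^ 2)) (convex_Ici 0) hc ?_ ?_
    · intro r hr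
      rw [interior_Ici] at hr
      exact (hd r hr).hasDerivWithinAt
    · intro r hr
      rw [interior_Ici] at hr
      have : 0 < r := hr
      positivity
  have hnn : ∀ r, 0 < r → 0 ≤ M r := fun r hr => by
    rw [← hM0]; exact hmono (Set.mem_Ici.2 le_rfl) hr.le hr.le
  have hN : ∀ r, 0 < r → auxA ν r ^ 2 - ν * auxA ν r * auxA (ν + 1) r - r * auxA (ν + 1) r ^ 2 ≠ 0 := by
    intro r hr h0
    have h1 := hnn r hr
    simp only [hM, h0] at h1
    have h2 : 0 < r ^ (ν + 1) * auxA ν r ^ 2 :=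
      mul_pos (Real.rpow_pos_of_pos hr _) (pow_pos (auxA_pos ν hν r hr.le) 2)
    linarith
  have hstrict : StrictMonoOn M (Set.Ici 0) := by
    refine strictMonoOn_of_hasDerivWithinAt_pos (f' := fun s => (2 * s ^ (ν + 1) * (auxA ν s ^ 2 - ν * auxA ν s * auxA (ν + 1) s - s * auxA (ν + 1) s ^ 2) ^ 2 / auxA ν s ^ 2)) (convex_Ici 0) hc ?_ ?_
    · intro r hr
      rw [interior_Ici] at hr
      exact (hd r hr).hasDerivWithinAt
    · intro r hr
      rw [interior_Ici] at hr
      have h1 : 0 < r := hr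
      have h2 := hN r h1
      have h3 := auxA_pos ν hν r h1.le
      positivity
  have h := hstrict (Set.mem_Ici.2 le_rfl) (Set.mem_Ici.2 hs.le) hs
  rw [hM0] at h
  exact pos_of_mul_pos_right h (Real.rpow_nonneg hs.le _)

lemma auxJ_M_neg (ν : ℝ) (hν : 0 ≤ ν) (s : ℝ) (hs : 0 < s) :
    (auxJ ν s ^ 2 - ν * auxJ ν s * auxJ (ν - 1) s - s * auxJ (ν - 1) s ^ 2) *
      (1 - ν - 2 * s * auxJ (ν - 1) s / auxJ ν s) - auxJ ν s ^ 2 < 0 := by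
  set N : ℝ → ℝ := fun s => auxJ ν s ^ 2 - ν * auxJ ν s * auxJ (ν - 1) s - s * auxJ (ν - 1) s ^ 2 with hNdef
  set M : ℝ → ℝ := fun s => s ^ (-ν + 1) * (N s *
      (1 - ν - 2 * s * auxJ (ν - 1) s / auxJ ν s) - auxJ ν s ^ 2) with hM
  have hd : ∀ s : ℝ, 0 < s → HasDerivAt M (2 * s ^ (-ν + 1) * N s ^ 2 / auxJ ν s ^ 2) s := by
    intro s hs
    have key := aux_M_deriv (-ν) (auxJ ν) (fun s => -auxJ (ν - 1) s) s hs (auxJ_pos ν s hs).ne'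
      (auxJ_hasDerivAt ν s hs) ?_
    · have e1 : M = fun s => s ^ (-ν + 1) * ((auxJ ν s ^ 2 - -ν * auxJ ν s * -auxJ (ν - 1) s - s * (-auxJ (ν - 1) s) ^ 2) *
          (-ν + 1 + 2 * s * -auxJ (ν - 1) s / auxJ ν s) - auxJ ν s ^ 2) := by
        funext r
        simp only [hM, hNdef]
        ring
      rw [e1]
      refine key.congr_deriv ?_
      simp only [hNdef]
      ring
    · have := (auxJ_hasDerivAt (ν - 1) s hs).neg
      refine this.congr_deriv ?_
      have hr := auxJ_rec (ν - 1) s hs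
      rw [show ν - 1 + 1 = ν by ring] at hr
      rw [eq_div_iff hs.ne', hr]
      ring
  have hc : ContinuousOn M (Set.Ioi 0) := fun r hr => (hd r hr).continuousAt.continuousWithinAt
  have hmono : MonotoneOn M (Set.Ioi 0) := by
    refine monotoneOn_of_hasDerivWithinAt_nonneg (f' := fun s => (2 * s ^ (-ν + 1) * N s ^ 2 / auxJ ν s ^ 2)) (convex_Ioi 0) hc ?_ ?_
    · intro r hr
      rw [interior_Ioi] at hr
      exact (hd r hr).hasDerivWithinAt
    · intro r hr
      rw [interior_Ioi] at hr
      have : 0 < r := hr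
      positivity
  -- upper bound at infinity
  set C := (2 * Real.Gamma (ν + 2)) ^ 2 * ((2 + ν) * (3 + ν)) with hC
  have hub : ∀ r, 2 ≤ r → M r ≤ C * r⁻¹ := by
    intro r hr
    have r0 : 0 < r := by linarith
    have c0 := auxJ_pos ν r r0
    have d0 := auxJ_pos (ν - 1) r r0
    have hcv := auxJ_conv ν r r0
    have hrec := auxJ_rec (ν - 1) r r0
    rw [show ν - 1 + 1 = ν by ring, show ν - 1 - 1 = ν - 2 by ring] at hrec
    have hle := auxJ_le ν r r0 2 (by push_cast; positivity)
    have hcd : auxJ (ν - 1) r ≤ auxJ ν r := by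
      have h1 := mul_le_mul_of_nonneg_left hcv r0.le
      by_contra hcon
      push Not at hcon
      nlinarith [mul_nonneg hν d0.le]
    set c := auxJ ν r
    set d := auxJ (ν - 1) r
    have hq : d / c ≤ 1 := (div_le_one c0).2 hcd
    have hq0 : 0 ≤ d / c := by positivity
    have hNabs : |N r| ≤ c ^ 2 * ((2 + ν) * r) := by
      simp only [hNdef]
      have h1 : c * d ≤ c ^ 2 := by nlinarith
      have h2 : d ^ 2 ≤ c ^ 2 := by nlinarith
      have h3 : ν * (c * d) ≤ ν * c ^ 2 := by gcongr
      have h4 : r * d ^ 2 ≤ r * c ^ 2 := by gcongr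
      have h5 : 0 ≤ ν * (c * d) := by positivity
      have h6 : 0 ≤ r * d ^ 2 := by positivity
      have h7 : c ^ 2 * 1 ≤ c ^ 2 * r := by gcongr; linarith
      have h8 : ν * c ^ 2 * 1 ≤ ν * c ^ 2 * r := by gcongr; linarith
      rw [abs_le]; constructor <;> nlinarith
    have hWabs : |1 - ν - 2 * r * d / c| ≤ (3 + ν) * r := by
      have e : 2 * r * d / c = 2 * r * (d / c) := by ring
      rw [e]
      have h1 : r * (d / c) ≤ r * 1 := by gcongr
      have h2 : 0 ≤ r * (d / c) := by positivity
      have h3 : ν * 1 ≤ ν * r := by gcongr; linarith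
      rw [abs_le]; constructor <;> nlinarith
    have hprod : N r * (1 - ν - 2 * r * d / c) - c ^ 2 ≤ c ^ 2 * ((2 + ν) * r) * ((3 + ν) * r) := by
      have h1 := le_abs_self (N r * (1 - ν - 2 * r * d / c))
      rw [abs_mul] at h1
      have h2 := mul_le_mul hNabs hWabs (abs_nonneg _) (by positivity)
      have h3 : 0 ≤ c ^ 2 := by positivity
      linarith
    have hpow : r ^ (-ν + 1) ≤ r := by
      conv_rhs => rw [← Real.rpow_one r]
      exact Real.rpow_le_rpow_of_exponent_le (by linarith) (by linarith)
    have hc2 : c ^ 2 ≤ (2 * Real.Gamma (ν + 2)) ^ 2 / r ^ 4 := by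
      have : c ≤ 2 * Real.Gamma (ν + 2) / r ^ 2 := by
        refine hle.trans_eq ?_
        norm_num [Nat.factorial]
        ring
      calc c ^ 2 ≤ (2 * Real.Gamma (ν + 2) / r ^ 2) ^ 2 := by gcongr
        _ = _ := by rw [div_pow]; ring
    calc M r ≤ r ^ (-ν + 1) * (c ^ 2 * ((2 + ν) * r) * ((3 + ν) * r)) := by
          simp only [hM]; gcongr
      _ ≤ r * ((2 * Real.Gamma (ν + 2)) ^ 2 / r ^ 4 * ((2 + ν) * r) * ((3 + ν) * r)) := by gcongr
      _ = C * r⁻¹ := by rw [hC]; field_simp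
  have hnp : ∀ r, 0 < r → M r ≤ 0 := by
    intro r hr
    have ht : Tendsto (fun r : ℝ => C * r⁻¹) atTop (𝓝 0) := by
      simpa using tendsto_inv_atTop_zero.const_mul C
    refine ge_of_tendsto ht ?_
    filter_upwards [eventually_ge_atTop 2, eventually_ge_atTop r] with u hu2 hur
    exact (hmono hr (lt_of_lt_of_le hr hur) hur).trans (hub u hu2)
  have hs2 : ∀ r, 0 < r → M r < 0 := by
    -- strictness: where M = 0 on [r, ∞), the derivative vanishes at r + 1
    intro r hr
    refine lt_of_le_of_ne (hnp r hr) fun h0 => ?_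
    have hz : ∀ u, r ≤ u → M u = 0 := fun u hu =>
      le_antisymm (hnp u (hr.trans_le hu)) (h0 ▸ hmono hr (hr.trans_le hu) hu)
    have hr1 : 0 < r + 1 := by linarith
    have hev : M =ᶠ[𝓝 (r + 1)] fun _ => 0 := by
      filter_upwards [Ioi_mem_nhds (show r < r + 1 by linarith)] with u hu
      exact hz u (le_of_lt hu)
    have hder := (hd (r + 1) hr1).unique ((hasDerivAt_const (r + 1) (0 : ℝ)).congr_of_eventuallyEq hev)
    have hc0 := auxJ_pos ν (r + 1) hr1
    have hp0 : 0 < (r + 1) ^ (-ν + 1) := Real.rpow_pos_of_pos hr1 _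
    have hN0 : N (r + 1) = 0 := by
      by_contra hne
      have : 0 < 2 * (r + 1) ^ (-ν + 1) * N (r + 1) ^ 2 / auxJ ν (r + 1) ^ 2 := by positivity
      linarith
    have h1 := hz (r + 1) (by linarith)
    simp only [hM, hN0] at h1
    have : 0 < (r + 1) ^ (-ν + 1) * auxJ ν (r + 1) ^ 2 := by positivity
    linarith
  have h := hs2 s hs
  have hp0 : 0 < s ^ (-ν + 1) := Real.rpow_pos_of_pos hs _
  by_contra hcon
  push Not at hcon
  exact absurd h (not_lt.2 (mul_nonneg hp0.le hcon))

lemma aux_wronskian (ν : ℝ) (hν : 0 ≤ ν) (s : ℝ) (hs : 0 < s) :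
    auxA ν s * auxJ (ν + 1) s + s * auxA (ν + 1) s * auxJ ν s = 1 := by
  set W : ℝ → ℝ := fun s => auxA ν s * auxJ (ν + 1) s + s * auxA (ν + 1) s * auxJ ν s with hW
  have hd : ∀ r, 0 < r → HasDerivAt W 0 r := by
    intro r hr
    have h1 := (auxA_hasDerivAt ν hν r).mul (auxJ_hasDerivAt (ν + 1) r hr)
    have h2 := ((hasDerivAt_id r).mul (auxA_hasDerivAt (ν + 1) (by positivity) r)).mul (auxJ_hasDerivAt ν r hr)
    refine (h1.add h2).congr_deriv ?_
    have r1 := auxA_rec ν hν r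
    have r2 := auxJ_rec ν r hr
    rw [show ν + 1 + 1 = ν + 2 by ring, show ν + 1 - 1 = ν by ring]
    simp only [id, Pi.mul_apply]
    rw [r2]
    linear_combination auxJ ν r * r1
  have hconst : ∀ r, 0 < r → W r = W s := by
    intro r hr
    refine isOpen_Ioi.is_const_of_deriv_eq_zero (isPreconnected_Ioi (a := (0 : ℝ))) ?_ ?_ hr hs
    · exact fun u hu => (hd u hu).differentiableAt.differentiableWithinAt
    · exact fun u hu => (hd u hu).deriv
  have ht : Tendsto W (𝓝[>] 0) (𝓝 1) := by
    have hA : Tendsto (auxA ν) (𝓝[>] 0) (𝓝 (1 / Real.Gamma (ν + 1))) := by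
      rw [← auxA_zero]
      exact (auxA_hasDerivAt ν hν 0).continuousAt.tendsto.mono_left nhdsWithin_le_nhds
    have hB : Tendsto (auxA (ν + 1)) (𝓝[>] 0) (𝓝 (1 / Real.Gamma (ν + 1 + 1))) := by
      rw [← auxA_zero]
      exact (auxA_hasDerivAt (ν + 1) (by positivity) 0).continuousAt.tendsto.mono_left nhdsWithin_le_nhds
    have hJ1 := auxJ_tendsto (ν + 1) (by positivity)
    have hJ2 := auxJ_tendsto (ν + 1 + 1) (by positivity)
    have hG : 0 < Real.Gamma (ν + 1) := Real.Gamma_pos_of_pos (by positivity)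
    have h := (hA.mul hJ1).add (hB.mul (hJ2.sub (hJ1.const_mul (ν + 1))))
    rw [Real.Gamma_add_one (s := ν + 1) (by positivity), sub_self, mul_zero, add_zero, one_div,
      inv_mul_cancel₀ hG.ne'] at h
    refine h.congr' ?_
    filter_upwards [self_mem_nhdsWithin] with r hr
    have r2 := auxJ_rec (ν + 1) r hr
    rw [show ν + 1 - 1 = ν by ring] at r2
    simp only [hW]
    rw [r2]; ring
  have ht2 : Tendsto W (𝓝[>] 0) (𝓝 (W s)) := by
    refine tendsto_const_nhds.congr' ?_
    filter_upwards [self_mem_nhdsWithin] with r hr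
    exact (hconst r hr).symm
  exact tendsto_nhds_unique ht2 ht

lemma besselI_eq (ν x : ℝ) : besselI ν x = (x / 2) ^ ν * auxA ν (x ^ 2 / 4) := by
  unfold besselI auxA
  rw [tsum_mul_right, mul_comm]
  congr 2
  ext k
  rw [pow_mul, show (x / 2) ^ 2 = x ^ 2 / 4 by ring]

lemma besselK_eq (ν x : ℝ) (hx : 0 < x) :
    2 * ((x / 2) ^ ν * besselK ν x) = auxJ ν (x ^ 2 / 4) := by
  have hs : 0 < x ^ 2 / 4 := by positivity
  have hx2 : 0 < x / 2 := by positivity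
  set L := Real.log (x / 2) with hL
  have e : ∀ t : ℝ, Real.exp (ν * (t + L) - Real.exp (t + L) - x ^ 2 / 4 * Real.exp (-(t + L))) =
      (x / 2) ^ ν * Real.exp (ν * t - x * Real.cosh t) := by
    intro t
    have h1 : Real.exp (t + L) = x / 2 * Real.exp t := by
      rw [Real.exp_add, hL, Real.exp_log hx2, mul_comm]
    have h2 : Real.exp (-(t + L)) = (x / 2)⁻¹ * Real.exp (-t) := by
      rw [Real.exp_neg, h1, mul_inv, Real.exp_neg]
    rw [h1, h2, Real.rpow_def_of_pos hx2, ← Real.exp_add, Real.cosh_eq]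
    congr 1
    rw [← hL]
    field_simp
    ring
  have hi := (auxJ_integrable ν _ hs).comp_add_right L
  simp only [e] at hi
  have hr0 : (x / 2) ^ ν ≠ 0 := (Real.rpow_pos_of_pos hx2 ν).ne'
  have hi' : Integrable (fun t : ℝ => Real.exp (ν * t - x * Real.cosh t)) := by
    refine (hi.const_mul ((x / 2) ^ ν)⁻¹).congr (Eventually.of_forall fun t => ?_)
    simp only
    rw [inv_mul_cancel_left₀ hr0]
  have hJ : auxJ ν (x ^ 2 / 4) = (x / 2) ^ ν * ∫ t : ℝ, Real.exp (ν * t - x * Real.cosh t) := by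
    unfold auxJ
    rw [← integral_add_right_eq_self _ L, ← integral_const_mul]
    simp only [e]
  rw [hJ]
  have hneg := integral_comp_neg_Ioi (0 : ℝ) (fun t : ℝ => Real.exp (ν * t - x * Real.cosh t))
  rw [neg_zero] at hneg
  have hin := hi'.comp_neg
  rw [← intervalIntegral.integral_Iic_add_Ioi hi'.integrableOn hi'.integrableOn (b := 0), ← hneg,
    ← integral_add hin.integrableOn hi'.integrableOn]
  unfold besselK
  rw [mul_left_comm, ← integral_const_mul]
  congr 2
  ext t
  rw [Real.cosh_neg, Real.cosh_eq (ν * t), sub_eq_add_neg, sub_eq_add_neg, Real.exp_add, Real.exp_add]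
  rw [neg_mul, mul_neg]
  ring


end

theorem besselI_mul_besselK_trig_lower_bound (ν x : ℝ) (hν : 0 ≤ ν) (hx : 0 < x) :
    besselI ν x * besselK ν x >
      Real.sqrt 3 / (2 * Real.sqrt (3 * (ν ^ 2 + x ^ 2) + 1) *
        Real.sin (1 / 3 * Real.arccos ((9 * ν ^ 2 - 9 / 2 * x ^ 2 - 1) /
          Real.sqrt (3 * (ν ^ 2 + x ^ 2) + 1) ^ 3) + π / 3)) := by
  set s := x ^ 2 / 4 with hsdef
  have hs : 0 < s := by positivity
  have hx4 : x ^ 2 = 4 * s := by rw [hsdef]; ring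
  have hIK : besselI ν x * besselK ν x = auxA ν s * auxJ ν s / 2 := by
    rw [besselI_eq, ← besselK_eq ν x hx]; ring
  have ha := auxA_pos ν hν s hs.le
  have hc := auxJ_pos ν s hs
  have hb := auxA_pos (ν + 1) (by positivity) s hs.le
  have hd := auxJ_pos (ν - 1) s hs
  have hw := aux_wronskian ν hν s hs
  rw [auxJ_rec ν s hs] at hw
  have h1 := auxA_M_pos ν hν s hs
  have h2 := auxJ_M_neg ν hν s hs
  set a := auxA ν s
  set b := auxA (ν + 1) s
  set c := auxJ ν s
  set d := auxJ (ν - 1) s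
  have hdiff : (ν + 2 * s * b / a) - (-ν - 2 * s * d / c) = 2 / (a * c) := by
    field_simp
    linear_combination 2 * hw
  have key := aux_trig ν x (ν + 2 * s * b / a) (-ν - 2 * s * d / c) hx ?_ ?_ ?_
  · rw [hdiff] at key
    rw [hIK]
    rwa [one_div_div] at key
  · rw [hx4]
    have e : ((ν + 2 * s * b / a) ^ 2 - (ν ^ 2 + 4 * s)) * (ν + 2 * s * b / a + 1) + 4 * s =
      -(4 * s / a ^ 2 * ((a ^ 2 - ν * a * b - s * b ^ 2) * (ν + 1 + 2 * s * b / a) - a ^ 2)) := by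
      field_simp
      ring
    rw [e, neg_lt_zero]
    positivity
  · rw [hx4]
    have e : ((-ν - 2 * s * d / c) ^ 2 - (ν ^ 2 + 4 * s)) * (-ν - 2 * s * d / c + 1) + 4 * s =
      4 * s / c ^ 2 * (-((c ^ 2 - ν * c * d - s * d ^ 2) * (1 - ν - 2 * s * d / c) - c ^ 2)) := by
      field_simp
      ring
    rw [e]
    exact mul_pos (by positivity) (neg_pos.2 h2)
  · have : 0 < 2 / (a * c) := by positivity
    linarith
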